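/- Every generalized Cahen–Wallach spacetime CW^d_r(A) of order r is geodesically complete and its metric is real-analytic; in particular, the geodesic equations of g_A reduce, in the coordinates {u,v,x^i}, to a system of linear second-order ordinary differential equations with polynomial coefficients in the affine parameter, so every inextendible geodesic is defined on all of ℝ. -/

import Mathlib

/-!
Core framework: coordinate tensor calculus on `ℝⁿ` (partial derivatives, Christoffel
symbols, Riemann curvature, iterated covariant derivatives `∇ʳR`), and a notion of
pseudo-Riemannian manifold given by an atlas of metric charts whose transition
functions are smooth isometries.
-/

noncomputable section

open Matrix Set

/-- Partial derivative in the `i`-th coordinate direction. -/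
def pd {n : ℕ} (i : Fin n) (f : (Fin n → ℝ) → ℝ) (x : Fin n → ℝ) : ℝ :=
  fderiv ℝ f x (Pi.single i 1)

/-- A metric in coordinates: a matrix-valued function on (an open subset of) `ℝⁿ`. -/
abbrev MetricMat (n : ℕ) := (Fin n → ℝ) → Matrix (Fin n) (Fin n) ℝ

/-- Christoffel symbols `Γ^k_{ij}` of a coordinate metric. -/
def christoffel {n : ℕ} (g : MetricMat n) (x : Fin n → ℝ) (k i j : Fin n) : ℝ :=
  (1 / 2) * ∑ l, (g x)⁻¹ k l *
    (pd i (fun y => g y l j) x + pd j (fun y => g y l i) x - pd l (fun y => g y i j) x)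

/-- Curvature tensor `R^l_{kij}` (1,3) of a coordinate metric. -/
def curvUp {n : ℕ} (g : MetricMat n) (x : Fin n → ℝ) (l k i j : Fin n) : ℝ :=
  pd i (fun y => christoffel g y l j k) x - pd j (fun y => christoffel g y l i k) x
    + ∑ m, christoffel g x l i m * christoffel g x m j k
    - ∑ m, christoffel g x l j m * christoffel g x m i k

/-- Covariant tensor fields of valence `s` in coordinates. -/
abbrev TensorField (n s : ℕ) := (Fin n → ℝ) → (Fin s → Fin n) → ℝ

/-- The (0,4) Riemann curvature tensor `R_{lkij} = g_{lm} R^m_{kij}`. -/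
def riemann {n : ℕ} (g : MetricMat n) : TensorField n 4 := fun x idx =>
  ∑ m, g x (idx 0) m * curvUp g x m (idx 1) (idx 2) (idx 3)

/-- The Ricci tensor `R_{ij} = R^m_{imj}`. -/
def ricci {n : ℕ} (g : MetricMat n) (x : Fin n → ℝ) (i j : Fin n) : ℝ :=
  ∑ m, curvUp g x m i m j

/-- Covariant derivative of a covariant tensor field; the new (derivative) index is slot `0`. -/
def covDeriv {n s : ℕ} (g : MetricMat n) (T : TensorField n s) : TensorField n (s + 1) :=
  fun x idx =>
    pd (idx 0) (fun y => T y fun a => idx a.succ) x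
      - ∑ a : Fin s, ∑ e, christoffel g x e (idx 0) (idx a.succ)
          * T x (Function.update (fun b : Fin s => idx b.succ) a e)

/-- Iterated covariant derivative `∇ʳ R` of the curvature tensor. -/
def nablaR {n : ℕ} (g : MetricMat n) : (r : ℕ) → TensorField n (4 + r)
  | 0 => riemann g
  | r + 1 => covDeriv g (nablaR g r)

/-- `∇ʳ R = 0` on `U` (`r`-th symmetry in coordinates). -/
def RthSymmetricOn {n : ℕ} (g : MetricMat n) (U : Set (Fin n → ℝ)) (r : ℕ) : Prop :=
  ∀ x ∈ U, ∀ idx, nablaR g r x idx = 0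

/-- Vanishing curvature (flatness) on `U`. -/
def FlatOn {n : ℕ} (g : MetricMat n) (U : Set (Fin n → ℝ)) : Prop :=
  ∀ x ∈ U, ∀ idx, riemann g x idx = 0

/-- A symmetric matrix is of Lorentzian signature `(-,+,…,+)` iff it is congruent to
`diag(-1,1,…,1)`. -/
def IsLorentzMat {n : ℕ} (A : Matrix (Fin n) (Fin n) ℝ) : Prop :=
  ∃ P : Matrix (Fin n) (Fin n) ℝ, IsUnit P.det ∧
    Pᵀ * A * P = Matrix.diagonal fun i : Fin n => if (i : ℕ) = 0 then (-1 : ℝ) else 1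

/-- `τ` is smooth on `S` and pulls the metric `g₂` back to the metric `g₁` there. -/
def IsPullbackIsometry {n m : ℕ} (g₁ : MetricMat n) (g₂ : MetricMat m)
    (τ : (Fin n → ℝ) → Fin m → ℝ) (S : Set (Fin n → ℝ)) : Prop :=
  (∀ a : Fin m, ContDiffOn ℝ (⊤ : ℕ∞) (fun y => τ y a) S) ∧
  ∀ x ∈ S, ∀ i j : Fin n,
    g₁ x i j = ∑ a, ∑ b, g₂ (τ x) a b * pd i (fun y => τ y a) x * pd j (fun y => τ y b) x

/-- A metric chart on a topological space `M`: a homeomorphism of an open set of `M` onto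
an open set of `ℝⁿ`, together with the coordinate expression of the metric tensor. -/
structure MetricChart (n : ℕ) (M : Type) [TopologicalSpace M] where
  dom : Set M
  open_dom : IsOpen dom
  φ : M → Fin n → ℝ
  ψ : (Fin n → ℝ) → M
  ran : Set (Fin n → ℝ)
  open_ran : IsOpen ran
  maps_to : ∀ p ∈ dom, φ p ∈ ran
  maps_from : ∀ x ∈ ran, ψ x ∈ dom
  left_inv : ∀ p ∈ dom, ψ (φ p) = p
  right_inv : ∀ x ∈ ran, φ (ψ x) = x
  cont_phi : ContinuousOn φ dom
  cont_psi : ContinuousOn ψ ran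
  g : MetricMat n
  smooth_g : ∀ a b : Fin n, ContDiffOn ℝ (⊤ : ℕ∞) (fun x => g x a b) ran
  symm_g : ∀ x ∈ ran, (g x).IsSymm
  nondeg_g : ∀ x ∈ ran, IsUnit (g x).det

/-- An `n`-dimensional pseudo-Riemannian manifold: a topological space covered by metric
charts whose transition functions are (smooth) isometries for the chart metrics. -/
structure PRManifold (n : ℕ) where
  M : Type
  top : TopologicalSpace M
  chartAt : M → @MetricChart n M top
  mem_chart : ∀ p : M, p ∈ (chartAt p).dom
  compatible : ∀ p q : M,
    IsPullbackIsometry (chartAt p).g (chartAt q).g ((chartAt q).φ ∘ (chartAt p).ψ)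
      ((chartAt p).φ '' ((chartAt p).dom ∩ (chartAt q).dom))

attribute [instance] PRManifold.top

namespace PRManifold

variable {n : ℕ}

/-- The metric is Lorentzian, of signature `(-,+,…,+)`. -/
def IsLorentzian (X : PRManifold n) : Prop :=
  ∀ p : X.M, ∀ x ∈ (X.chartAt p).ran, IsLorentzMat ((X.chartAt p).g x)

/-- The metric is Riemannian (positive definite). -/
def IsRiemannian (X : PRManifold n) : Prop :=
  ∀ p : X.M, ∀ x ∈ (X.chartAt p).ran, ((X.chartAt p).g x).PosDef

/-- Connectedness of the underlying space. -/
def Conn (X : PRManifold n) : Prop := ConnectedSpace X.M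

/-- Simple connectedness of the underlying space. -/
def SimplyConn (X : PRManifold n) : Prop := SimplyConnectedSpace X.M

/-- `∇ʳ R = 0` (in every chart). -/
def RthSymmetric (X : PRManifold n) (r : ℕ) : Prop :=
  ∀ p : X.M, RthSymmetricOn (X.chartAt p).g (X.chartAt p).ran r

/-- `∇ʳ R = 0` but `∇^{r-1} R ≠ 0`. -/
def ProperRthSymmetric (X : PRManifold n) (r : ℕ) : Prop :=
  X.RthSymmetric r ∧ ¬ X.RthSymmetric (r - 1)

/-- The curvature tensor vanishes identically. -/
def Flat (X : PRManifold n) : Prop :=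
  ∀ p : X.M, FlatOn (X.chartAt p).g (X.chartAt p).ran

/-- The Ricci tensor vanishes identically. -/
def RicciFlat (X : PRManifold n) : Prop :=
  ∀ p : X.M, ∀ x ∈ (X.chartAt p).ran, ∀ i j, ricci (X.chartAt p).g x i j = 0

end PRManifold

/-- A curve `c` (written in coordinates) is a geodesic of `g` on the parameter set `I`:
its components are twice differentiable and satisfy the geodesic equations. -/
def IsGeodesicCurve {n : ℕ} (g : MetricMat n) (I : Set ℝ) (c : ℝ → Fin n → ℝ) : Prop :=
  ∀ t ∈ I, ∀ k : Fin n,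
    DifferentiableAt ℝ (fun s => c s k) t ∧
    DifferentiableAt ℝ (deriv fun s => c s k) t ∧
    deriv (deriv fun s => c s k) t
      + ∑ i, ∑ j, christoffel g (c t) k i j * deriv (fun s => c s i) t
          * deriv (fun s => c s j) t = 0

namespace PRManifold

variable {n : ℕ}

/-- `γ` is a geodesic of `X` on the parameter set `I`: around each parameter it lies in a
chart and its coordinate expression solves the geodesic equations there. -/
def IsGeodesic (X : PRManifold n) (I : Set ℝ) (γ : ℝ → X.M) : Prop :=
  ∀ t ∈ I, ∃ p : X.M, ∃ ε > (0 : ℝ),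
    (∀ s ∈ I ∩ Set.Ioo (t - ε) (t + ε), γ s ∈ (X.chartAt p).dom) ∧
    IsGeodesicCurve (X.chartAt p).g (I ∩ Set.Ioo (t - ε) (t + ε))
      (fun s => (X.chartAt p).φ (γ s))

/-- Geodesic completeness: every (nontrivial) geodesic defined on an open interval
extends to a geodesic defined on all of `ℝ`. -/
def GeodesicallyComplete (X : PRManifold n) : Prop :=
  ∀ (a b : ℝ) (γ : ℝ → X.M), (Set.Ioo a b).Nonempty → X.IsGeodesic (Set.Ioo a b) γ →
    ∃ γ' : ℝ → X.M, X.IsGeodesic Set.univ γ' ∧ ∀ t ∈ Set.Ioo a b, γ' t = γ t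

end PRManifold

/-- First block of coordinates of a product. -/
def split1 {n₁ n₂ : ℕ} (x : Fin (n₁ + n₂) → ℝ) : Fin n₁ → ℝ := fun i => x (Fin.castAdd n₂ i)

/-- Second block of coordinates of a product. -/
def split2 {n₁ n₂ : ℕ} (x : Fin (n₁ + n₂) → ℝ) : Fin n₂ → ℝ := fun j => x (Fin.natAdd n₁ j)

/-- The direct-product (block diagonal) metric `g₁ ⊕ g₂` in coordinates. -/
def prodMetricMat {n₁ n₂ : ℕ} (G₁ : MetricMat n₁) (G₂ : MetricMat n₂) :
    MetricMat (n₁ + n₂) := fun x =>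
  (Matrix.fromBlocks (G₁ (split1 x)) 0 0 (G₂ (split2 x))).submatrix
    finSumFinEquiv.symm finSumFinEquiv.symm

/-- The (generalized Cahen–Wallach / plane-wave) metric
`g = -2du(dv + P_{ij}(u)xⁱxʲ du) + δ_{ij} dxⁱ dxʲ` on `ℝ^{e+2}`,
with coordinates `x 0 = u`, `x 1 = v` and spatial coordinates `x i.succ.succ`. -/
def cwMetric (e : ℕ) (P : ℝ → Matrix (Fin e) (Fin e) ℝ) : MetricMat (e + 2) := fun x k l =>
  (if k = 0 ∧ l = 0 then (-2) * ∑ i, ∑ j, P (x 0) i j * x i.succ.succ * x j.succ.succ else 0)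
  + (if (k = 0 ∧ l = 1) ∨ (k = 1 ∧ l = 0) then -1 else 0)
  + (if k = l ∧ 2 ≤ (k : ℕ) then 1 else 0)

/-- The Brinkmann metric `ds² = -2du(dv + H du + Wᵢ dxⁱ) + g_{ij} dxⁱ dxʲ` on `ℝ^{d+2}`,
with coordinates `x 0 = u`, `x 1 = v` and spatial coordinates `x i.succ.succ`. -/
def brinkmannMat (d : ℕ) (H : (Fin (d + 2) → ℝ) → ℝ) (W : Fin d → (Fin (d + 2) → ℝ) → ℝ)
    (gs : (Fin (d + 2) → ℝ) → Matrix (Fin d) (Fin d) ℝ) : MetricMat (d + 2) := fun x k l =>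
  (if k = 0 ∧ l = 0 then (-2) * H x else 0)
  + (if (k = 0 ∧ l = 1) ∨ (k = 1 ∧ l = 0) then -1 else 0)
  + (if k = 0 then ∑ i : Fin d, if l = i.succ.succ then -(W i x) else 0 else 0)
  + (if l = 0 then ∑ i : Fin d, if k = i.succ.succ then -(W i x) else 0 else 0)
  + ∑ i : Fin d, ∑ j : Fin d, if k = i.succ.succ ∧ l = j.succ.succ then gs x i j else 0

/-- A function on `ℝ^{d+2}` is independent of the coordinate `v = x 1`. -/
def vIndep {d : ℕ} {α : Type*} (f : (Fin (d + 2) → ℝ) → α) : Prop :=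
  ∀ x t, f (Function.update x (1 : Fin (d + 2)) t) = f x

/-- The point of `ℝ^{d+2}` with `u`, `v` and spatial coordinates `u`, `v`, `y`. -/
def emb (d : ℕ) (u v : ℝ) (y : Fin d → ℝ) : Fin (d + 2) → ℝ :=
  Fin.cons u (Fin.cons v y)
-- extension layer (appended to core for testing)
namespace PRManifold

variable {n : ℕ}

/-- A self-map of `Y` is a (global) isometry: it is a homeomorphism and, read in the
charts, it pulls the metric back to the metric. -/
def IsAutoIsometry (Y : PRManifold n) (σ : Y.M → Y.M) : Prop :=
  Function.Bijective σ ∧ Continuous σ ∧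
    ∀ q : Y.M, ∃ S, IsOpen S ∧ (Y.chartAt q).φ q ∈ S ∧ S ⊆ (Y.chartAt q).ran ∧
      (∀ x ∈ S, σ ((Y.chartAt q).ψ x) ∈ (Y.chartAt (σ q)).dom) ∧
      IsPullbackIsometry (Y.chartAt q).g (Y.chartAt (σ q)).g
        (fun x => (Y.chartAt (σ q)).φ (σ ((Y.chartAt q).ψ x))) S

/-- `Y` is a (globally) symmetric space: the geodesic symmetry at every point extends to
a global isometry, i.e. every point is an isolated fixed point of a global isometry whose
differential there is `-id` (in chart coordinates). -/
def IsSymmetricSpace (Y : PRManifold n) : Prop :=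
  ∀ q : Y.M, ∃ σ : Y.M → Y.M, Y.IsAutoIsometry σ ∧ σ q = q ∧
    ∀ a i : Fin n,
      pd i (fun x => (Y.chartAt (σ q)).φ (σ ((Y.chartAt q).ψ x)) a) ((Y.chartAt q).φ q)
        = -(if i = a then 1 else 0)

/-- The metric of `X` is real-analytic: around every point there are coordinates in which
the metric components are real-analytic functions. -/
def AnalyticMetric (X : PRManifold n) : Prop :=
  ∀ p : X.M, ∃ S, IsOpen S ∧ (X.chartAt p).φ p ∈ S ∧ S ⊆ (X.chartAt p).ran ∧
    ∃ (τ : (Fin n → ℝ) → Fin n → ℝ) (G : MetricMat n),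
      Set.InjOn τ S ∧ (∀ a b : Fin n, AnalyticOnNhd ℝ (fun y => G y a b) (τ '' S)) ∧
      IsPullbackIsometry (X.chartAt p).g G τ S

end PRManifold

/-- `Z` is globally isometric to the direct product `X × Y` (with the product metric):
there is a bijection which, read in charts, is an isometry onto the product. -/
def GloballyIsometricToProd {n₀ n₁ n₂ : ℕ} (Z : PRManifold n₀)
    (X : PRManifold n₁) (Y : PRManifold n₂) : Prop :=
  ∃ F : Z.M → X.M × Y.M, Function.Bijective F ∧
    ∀ p : Z.M, ∃ S, IsOpen S ∧ (Z.chartAt p).φ p ∈ S ∧ S ⊆ (Z.chartAt p).ran ∧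
      (∀ x ∈ S, (F ((Z.chartAt p).ψ x)).1 ∈ (X.chartAt (F p).1).dom
        ∧ (F ((Z.chartAt p).ψ x)).2 ∈ (Y.chartAt (F p).2).dom) ∧
      IsPullbackIsometry (Z.chartAt p).g
        (prodMetricMat (X.chartAt (F p).1).g (Y.chartAt (F p).2).g)
        (fun x => Fin.append ((X.chartAt (F p).1).φ (F ((Z.chartAt p).ψ x)).1)
          ((Y.chartAt (F p).2).φ (F ((Z.chartAt p).ψ x)).2)) S

/-- `X` is globally isometric to the direct product of the coordinate spacetime
`(ℝ^{e+2}, Gcw)` and `Y` (with the product metric). -/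
def GloballyIsometricToCWProd {n e m : ℕ} (X : PRManifold n) (Gcw : MetricMat (e + 2))
    (Y : PRManifold m) : Prop :=
  ∃ F : X.M → (Fin (e + 2) → ℝ) × Y.M, Function.Bijective F ∧
    ∀ p : X.M, ∃ S, IsOpen S ∧ (X.chartAt p).φ p ∈ S ∧ S ⊆ (X.chartAt p).ran ∧
      (∀ x ∈ S, (F ((X.chartAt p).ψ x)).2 ∈ (Y.chartAt (F p).2).dom) ∧
      IsPullbackIsometry (X.chartAt p).g (prodMetricMat Gcw (Y.chartAt (F p).2).g)
        (fun x => Fin.append (F ((X.chartAt p).ψ x)).1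
          ((Y.chartAt (F p).2).φ (F ((X.chartAt p).ψ x)).2)) S

/-- `X` is locally isometric to the direct product of the coordinate spacetime
`(ℝ^{e+2}, Gcw)` and `Y`: every point has a neighbourhood that maps isometrically into
the product. -/
def LocallyIsometricToCWProd {n e m : ℕ} (X : PRManifold n) (Gcw : MetricMat (e + 2))
    (Y : PRManifold m) : Prop :=
  ∀ p : X.M, ∃ q : Y.M, ∃ S, IsOpen S ∧ (X.chartAt p).φ p ∈ S ∧ S ⊆ (X.chartAt p).ran ∧
    ∃ τ : (Fin n → ℝ) → Fin ((e + 2) + m) → ℝ,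
      (∀ x ∈ S, split2 (n₁ := e + 2) (τ x) ∈ (Y.chartAt q).ran) ∧
      IsPullbackIsometry (X.chartAt p).g (prodMetricMat Gcw (Y.chartAt q).g) τ S

/-- An identification of `Σ i, Fin (m i)` with `Fin (∑ i, m i)`. -/
def sigmaFinEquiv {k : ℕ} (m : Fin k → ℕ) : (Σ i : Fin k, Fin (m i)) ≃ Fin (∑ i, m i) :=
  (Fintype.equivFin _).trans (finCongr (by simp))

/-- The `i`-th block of coordinates in `ℝ^{∑ mdim}`. -/
def sigCoord {k : ℕ} {mdim : Fin k → ℕ} (x : Fin (∑ i, mdim i) → ℝ) (i : Fin k) :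
    Fin (mdim i) → ℝ := fun a => x (sigmaFinEquiv mdim ⟨i, a⟩)

/-- The block-diagonal metric of a finite direct product, in coordinates. -/
def multiBlockMetric {k : ℕ} {mdim : Fin k → ℕ}
    (G : (i : Fin k) → MetricMat (mdim i)) : MetricMat (∑ i, mdim i) := fun x a b =>
  let sa := (sigmaFinEquiv mdim).symm a
  let sb := (sigmaFinEquiv mdim).symm b
  if h : sa.1 = sb.1 then G sb.1 (sigCoord x sb.1) (h ▸ sa.2) sb.2 else 0

/-- `X` is globally isometric to the direct product of the coordinate spacetime
`(ℝ^d, Gcw)` with the finite family of manifolds `Y i` (with the product metric). -/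
def GloballyIsometricToCWMultiProd {n d k : ℕ} {mdim : Fin k → ℕ}
    (X : PRManifold n) (Gcw : MetricMat d)
    (Y : (i : Fin k) → PRManifold (mdim i)) : Prop :=
  ∃ F : X.M → (Fin d → ℝ) × ((i : Fin k) → (Y i).M), Function.Bijective F ∧
    ∀ p : X.M, ∃ S, IsOpen S ∧ (X.chartAt p).φ p ∈ S ∧ S ⊆ (X.chartAt p).ran ∧
      (∀ x ∈ S, ∀ i, (F ((X.chartAt p).ψ x)).2 i ∈ ((Y i).chartAt ((F p).2 i)).dom) ∧
      IsPullbackIsometry (X.chartAt p).g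
        (prodMetricMat Gcw (multiBlockMetric fun i => ((Y i).chartAt ((F p).2 i)).g))
        (fun x => Fin.append (F ((X.chartAt p).ψ x)).1
          (fun j => let s := (sigmaFinEquiv mdim).symm j
            ((Y s.1).chartAt ((F p).2 s.1)).φ ((F ((X.chartAt p).ψ x)).2 s.1) s.2)) S

/-- `X` is locally isometric to the direct product of the coordinate spacetime
`(ℝ^d, Gcw)` with the finite family of manifolds `Y i`. -/
def LocallyIsometricToCWMultiProd {n d k : ℕ} {mdim : Fin k → ℕ}
    (X : PRManifold n) (Gcw : MetricMat d)
    (Y : (i : Fin k) → PRManifold (mdim i)) : Prop :=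
  ∀ p : X.M, ∃ q : (i : Fin k) → (Y i).M, ∃ S, IsOpen S ∧ (X.chartAt p).φ p ∈ S ∧
    S ⊆ (X.chartAt p).ran ∧
    ∃ τ : (Fin n → ℝ) → Fin (d + ∑ i, mdim i) → ℝ,
      (∀ x ∈ S, ∀ i : Fin k,
        sigCoord (split2 (n₁ := d) (τ x)) i ∈ ((Y i).chartAt (q i)).ran) ∧
      IsPullbackIsometry (X.chartAt p).g
        (prodMetricMat Gcw (multiBlockMetric fun i => ((Y i).chartAt (q i)).g)) τ S

/-- `X'` (with projection `π`) is a universal covering of `X`, with the pulled-back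
metric: `π` is a topological covering map, `X'` is simply connected and `π` is a local
isometry. -/
def IsUniversalCoverOf {n : ℕ} (X' X : PRManifold n) (π : X'.M → X.M) : Prop :=
  IsCoveringMap π ∧ X'.SimplyConn ∧
    ∀ p : X'.M, ∃ S, IsOpen S ∧ (X'.chartAt p).φ p ∈ S ∧ S ⊆ (X'.chartAt p).ran ∧
      (∀ x ∈ S, π ((X'.chartAt p).ψ x) ∈ (X.chartAt (π p)).dom) ∧
      IsPullbackIsometry (X'.chartAt p).g (X.chartAt (π p)).g
        (fun x => (X.chartAt (π p)).φ (π ((X'.chartAt p).ψ x))) S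

/-- A function `ℝ → ℝ` is polynomial. -/
def IsPolynomial1 (f : ℝ → ℝ) : Prop := ∃ P : Polynomial ℝ, ∀ t, f t = Polynomial.eval t P

/-- The terms of the Picard iteration series for `y' = L(t) y + F(t)`, `y t₀ = y₀`. -/
def linearODETerm {E : Type*} [NormedAddCommGroup E] [NormedSpace ℝ E]
    (L : ℝ → E →L[ℝ] E) (F : ℝ → E) (t₀ : ℝ) (y₀ : E) : ℕ → ℝ → E
  | 0 => fun t => y₀ + ∫ s in t₀..t, F s
  | n + 1 => fun t => ∫ s in t₀..t, L s (linearODETerm L F t₀ y₀ n s)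

section LinearODE

variable {E : Type*} [NormedAddCommGroup E] [NormedSpace ℝ E]
  {L : ℝ → E →L[ℝ] E} {F : ℝ → E}

theorem hasDerivAt_linearODETerm_zero [CompleteSpace E] (hF : Continuous F) (t₀ : ℝ) (y₀ : E)
    (t : ℝ) :
    HasDerivAt (linearODETerm L F t₀ y₀ 0) (F t) t :=
  (hF.integral_hasStrictDerivAt t₀ t).hasDerivAt.const_add y₀

theorem continuous_linearODETerm [CompleteSpace E] (hL : Continuous L)
    (hF : Continuous F) (t₀ : ℝ) (y₀ : E) (n : ℕ) : Continuous (linearODETerm L F t₀ y₀ n) := by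
  induction n with
  | zero =>
    exact continuous_iff_continuousAt.2 fun t =>
      (hasDerivAt_linearODETerm_zero hF t₀ y₀ t).continuousAt
  | succ n ih =>
    exact continuous_iff_continuousAt.2 fun t =>
      ((hL.clm_apply ih).integral_hasStrictDerivAt t₀ t).hasDerivAt.continuousAt

theorem hasDerivAt_linearODETerm_succ [CompleteSpace E] (hL : Continuous L)
    (hF : Continuous F) (t₀ : ℝ) (y₀ : E) (n : ℕ) (t : ℝ) :
    HasDerivAt (linearODETerm L F t₀ y₀ (n + 1)) (L t (linearODETerm L F t₀ y₀ n t)) t :=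
  ((hL.clm_apply (continuous_linearODETerm hL hF t₀ y₀ n)).integral_hasStrictDerivAt
    t₀ t).hasDerivAt

theorem norm_linearODETerm_le [CompleteSpace E] (hL : Continuous L)
    (hF : Continuous F) {t₀ : ℝ} {y₀ : E} {T K B : ℝ} (hK₀ : 0 ≤ K)
    (hK : ∀ t ∈ Metric.closedBall t₀ T, ‖L t‖ ≤ K)
    (hB : ∀ t ∈ Metric.closedBall t₀ T, ‖linearODETerm L F t₀ y₀ 0 t‖ ≤ B) (n : ℕ) :
    ∀ t ∈ Metric.closedBall t₀ T,
      ‖linearODETerm L F t₀ y₀ n t‖ ≤ B * K ^ n * (|t - t₀| ^ n / n.factorial) := by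
  induction n with
  | zero => simpa using hB
  | succ n ih =>
    intro t ht
    have hmem : ∀ s ∈ Set.uIoc t₀ t, s ∈ Metric.closedBall t₀ T := fun s hs => by
      rw [Metric.mem_closedBall, Real.dist_eq] at ht ⊢
      exact (Set.abs_sub_left_of_mem_uIcc (Set.uIoc_subset_uIcc hs)).trans ht
    have hcont := hL.clm_apply (continuous_linearODETerm hL hF t₀ y₀ n)
    calc ‖linearODETerm L F t₀ y₀ (n + 1) t‖
        ≤ ∫ s in Set.uIoc t₀ t, ‖L s (linearODETerm L F t₀ y₀ n s)‖ :=
          intervalIntegral.norm_integral_le_integral_norm_uIoc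
      _ ≤ ∫ s in Set.uIoc t₀ t, B * K ^ (n + 1) / n.factorial * |s - t₀| ^ n := by
          refine MeasureTheory.setIntegral_mono_on ?_ ?_ measurableSet_uIoc fun s hs => ?_
          · exact (hcont.norm.intervalIntegrable t₀ t).def'
          · exact ((by fun_prop : Continuous fun s : ℝ =>
              B * K ^ (n + 1) / n.factorial * |s - t₀| ^ n).intervalIntegrable t₀ t).def'
          · calc ‖L s (linearODETerm L F t₀ y₀ n s)‖
                ≤ ‖L s‖ * ‖linearODETerm L F t₀ y₀ n s‖ := (L s).le_opNorm _
              _ ≤ K * (B * K ^ n * (|s - t₀| ^ n / n.factorial)) :=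
                  mul_le_mul (hK s (hmem s hs)) (ih s (hmem s hs)) (norm_nonneg _) hK₀
              _ = B * K ^ (n + 1) / n.factorial * |s - t₀| ^ n := by ring
      _ = B * K ^ (n + 1) * (|t - t₀| ^ (n + 1) / (n + 1).factorial) := by
          rw [MeasureTheory.integral_const_mul, integral_pow_abs_sub_uIoc, Nat.factorial_succ]
          push_cast
          field_simp

/-- A linear first-order ODE with continuous coefficients has a solution on all of `ℝ`. -/
theorem exists_forall_hasDerivAt_linear [CompleteSpace E] (hL : Continuous L)
    (hF : Continuous F) (t₀ : ℝ) (y₀ : E) :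
    ∃ y : ℝ → E, y t₀ = y₀ ∧ ∀ t, HasDerivAt y (L t (y t) + F t) t := by
  have h₀ : ∀ n, linearODETerm L F t₀ y₀ (n + 1) t₀ = 0 := fun n => by simp [linearODETerm]
  refine ⟨fun t => linearODETerm L F t₀ y₀ 0 t + ∑' n, linearODETerm L F t₀ y₀ (n + 1) t,
    ?_, fun t => ?_⟩
  · simp only [h₀, tsum_zero, add_zero]
    simp [linearODETerm]
  let T := |t - t₀| + 1
  have hTpos : 0 < T := by positivity
  have hcpt := isCompact_closedBall t₀ T
  obtain ⟨K, hK⟩ := hcpt.exists_bound_of_continuousOn hL.continuousOn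
  obtain ⟨B, hB⟩ := hcpt.exists_bound_of_continuousOn
    (continuous_linearODETerm hL hF t₀ y₀ 0).continuousOn
  have hcenter : t₀ ∈ Metric.closedBall t₀ T := Metric.mem_closedBall_self hTpos.le
  have hK₀ : 0 ≤ K := (norm_nonneg _).trans (hK t₀ hcenter)
  have hB₀ : 0 ≤ B := (norm_nonneg _).trans (hB t₀ hcenter)
  have hterm := norm_linearODETerm_le hL hF hK₀ hK hB
  have hexp : Summable fun n : ℕ => B * ((K * T) ^ n / n.factorial) :=
    (Real.summable_pow_div_factorial (K * T)).mul_left B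
  have hbound : ∀ n, ∀ s ∈ Metric.closedBall t₀ T,
      ‖linearODETerm L F t₀ y₀ n s‖ ≤ B * ((K * T) ^ n / n.factorial) := fun n s hs => by
    refine (hterm n s hs).trans ?_
    rw [mul_pow, mul_assoc, ← mul_div_assoc]
    rw [Metric.mem_closedBall, Real.dist_eq] at hs
    gcongr
  have htmem : t ∈ Metric.ball t₀ T := by
    rw [Metric.mem_ball, Real.dist_eq]
    exact lt_add_one _
  have hsum : Summable fun n => linearODETerm L F t₀ y₀ n t :=
    hexp.of_norm_bounded fun n => hbound n t (Metric.ball_subset_closedBall htmem)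
  have hderiv := hasDerivAt_tsum_of_isPreconnected
    (g := fun n => linearODETerm L F t₀ y₀ (n + 1))
    (g' := fun n s => L s (linearODETerm L F t₀ y₀ n s))
    (hexp.mul_left K) Metric.isOpen_ball (convex_ball t₀ T).isPreconnected
    (fun n s _ => hasDerivAt_linearODETerm_succ hL hF t₀ y₀ n s)
    (fun n s hs =>
      have hs := Metric.ball_subset_closedBall hs
      ((L s).le_opNorm _).trans (mul_le_mul (hK s hs) (hbound n s hs) (norm_nonneg _) hK₀))
    (Metric.mem_ball_self hTpos) (by simp only [h₀, summable_zero]) htmem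
  beta_reduce
  rw [← hsum.tsum_eq_zero_add, (L t).map_tsum hsum, add_comm]
  exact (hasDerivAt_linearODETerm_zero hF t₀ y₀ t).add hderiv

/-- A linear second-order ODE with continuous coefficients has a solution on all of `ℝ`. -/
theorem exists_forall_hasDerivAt_linear_second_order [CompleteSpace E] (hL : Continuous L)
    (hF : Continuous F) (t₀ : ℝ) (x₀ w₀ : E) :
    ∃ x w : ℝ → E, x t₀ = x₀ ∧ w t₀ = w₀ ∧ (∀ t, HasDerivAt x (w t) t) ∧
      ∀ t, HasDerivAt w (L t (x t) + F t) t := by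
  obtain ⟨y, hy₀, hy⟩ := exists_forall_hasDerivAt_linear (E := E × E)
    (L := fun t => ContinuousLinearMap.inl ℝ E E ∘L ContinuousLinearMap.snd ℝ E E
      + ContinuousLinearMap.inr ℝ E E ∘L L t ∘L ContinuousLinearMap.fst ℝ E E)
    (F := fun t => (0, F t)) (by fun_prop) (by fun_prop) t₀ (x₀, w₀)
  refine ⟨fun t => (y t).1, fun t => (y t).2, by simp [hy₀], by simp [hy₀], fun t => ?_,
    fun t => ?_⟩
  · simpa [Function.comp_def] using hasFDerivAt_fst.comp_hasDerivAt t (hy t)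
  · simpa [Function.comp_def] using hasFDerivAt_snd.comp_hasDerivAt t (hy t)

/-- Uniqueness for a linear second-order ODE with continuous coefficients. -/
theorem eqOn_of_hasDerivAt_linear_second_order (hL : Continuous L) {a b t₀ : ℝ}
    (ht₀ : t₀ ∈ Set.Ioo a b) {x w x' w' : ℝ → E}
    (hx : ∀ t ∈ Set.Ioo a b, HasDerivAt x (w t) t)
    (hw : ∀ t ∈ Set.Ioo a b, HasDerivAt w (L t (x t) + F t) t)
    (hx' : ∀ t ∈ Set.Ioo a b, HasDerivAt x' (w' t) t)
    (hw' : ∀ t ∈ Set.Ioo a b, HasDerivAt w' (L t (x' t) + F t) t)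
    (hxe : x t₀ = x' t₀) (hwe : w t₀ = w' t₀) :
    Set.EqOn x x' (Set.Ioo a b) ∧ Set.EqOn w w' (Set.Ioo a b) := by
  obtain ⟨K, hK⟩ := (isCompact_Icc (a := a) (b := b)).exists_bound_of_continuousOn
    hL.continuousOn
  have hlip : ∀ t ∈ Set.Ioo a b, LipschitzOnWith (max 1 K.toNNReal)
      (fun z : E × E => (z.2, L t z.1 + F t)) Set.univ := fun t ht => by
    have h₂ : LipschitzWith K.toNNReal (fun z : E × E => L t z.1 + F t) :=
      LipschitzWith.of_dist_le_mul fun z z' => by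
        have hLK := (hK t (Set.Ioo_subset_Icc_self ht)).trans (Real.le_coe_toNNReal K)
        calc dist (L t z.1 + F t) (L t z'.1 + F t) = ‖L t (z.1 - z'.1)‖ := by
              rw [dist_add_right, dist_eq_norm, map_sub]
          _ ≤ K.toNNReal * ‖z.1 - z'.1‖ := (L t).le_of_opNorm_le hLK _
          _ ≤ K.toNNReal * dist z z' := by
              rw [← dist_eq_norm, Prod.dist_eq]
              gcongr
              exact le_max_left _ _
    exact (LipschitzWith.prod_snd.prodMk h₂).lipschitzOnWith
  have heq := ODE_solution_unique_of_mem_Ioo (f := fun t => (x t, w t))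
    (g := fun t => (x' t, w' t)) hlip ht₀
    (fun t ht => ⟨(hx t ht).prodMk (hw t ht), Set.mem_univ _⟩)
    (fun t ht => ⟨(hx' t ht).prodMk (hw' t ht), Set.mem_univ _⟩) (by simp [hxe, hwe])
  exact ⟨fun t ht => congrArg Prod.fst (heq ht), fun t ht => congrArg Prod.snd (heq ht)⟩

end LinearODE

/-- The quadratic form `P_{ij}(u) xⁱ xʲ` in the `du²` component of `cwMetric`. -/
def cwProfile (e : ℕ) (P : ℝ → Matrix (Fin e) (Fin e) ℝ) (x : Fin (e + 2) → ℝ) : ℝ :=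
  ∑ i, ∑ j, P (x 0) i j * x i.succ.succ * x j.succ.succ

section CahenWallach

variable {e : ℕ} {P : ℝ → Matrix (Fin e) (Fin e) ℝ} {x : Fin (e + 2) → ℝ}

theorem fderiv_cwProfile {P' : Matrix (Fin e) (Fin e) ℝ}
    (hP : ∀ i j, HasDerivAt (fun u => P u i j) (P' i j) (x 0)) (w : Fin (e + 2) → ℝ) :
    fderiv ℝ (cwProfile e P) x w = ∑ i : Fin e, ∑ j : Fin e,
      (P' i j * w 0 * x i.succ.succ * x j.succ.succ
        + P (x 0) i j * w i.succ.succ * x j.succ.succ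
        + P (x 0) i j * x i.succ.succ * w j.succ.succ) := by
  have hcoord : ∀ k : Fin (e + 2), HasFDerivAt (fun y : Fin (e + 2) → ℝ => y k)
      (ContinuousLinearMap.proj (R := ℝ) (φ := fun _ : Fin (e + 2) => ℝ) k) x :=
    fun k => hasFDerivAt_apply k x
  have h := HasFDerivAt.fun_sum (u := Finset.univ) fun i (_ : i ∈ Finset.univ) =>
    HasFDerivAt.fun_sum (u := Finset.univ) fun j (_ : j ∈ Finset.univ) =>
      (((hP i j).comp_hasFDerivAt x (hcoord 0)).mul (hcoord i.succ.succ)).mul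
        (hcoord j.succ.succ)
  have h' : fderiv ℝ (cwProfile e P) x = _ := HasFDerivAt.fderiv h
  rw [h']
  simp only [_root_.sum_apply, _root_.add_apply,
    _root_.smul_apply, ContinuousLinearMap.proj_apply, smul_eq_mul,
    Function.comp_apply]
  refine Finset.sum_congr rfl fun i _ => Finset.sum_congr rfl fun j _ => ?_
  simp
  ring

theorem sum_pd_mul {n : ℕ} (f : (Fin n → ℝ) → ℝ) (x w : Fin n → ℝ) :
    ∑ i, pd i f x * w i = fderiv ℝ f x w := by
  conv_rhs => rw [pi_eq_sum_univ' w, map_sum]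
  refine Finset.sum_congr rfl fun i _ => ?_
  rw [map_smul, smul_eq_mul, mul_comm]
  rfl

theorem pd_cwMetric (i k l : Fin (e + 2)) :
    pd i (fun y => cwMetric e P y k l) x
      = if k = 0 ∧ l = 0 then (-2) * pd i (cwProfile e P) x else 0 := by
  unfold pd
  by_cases h : k = 0 ∧ l = 0
  · obtain ⟨rfl, rfl⟩ := h
    have : (fun y => cwMetric e P y 0 0) = (-2 : ℝ) • cwProfile e P := by
      funext y
      simp [cwMetric, cwProfile]
    rw [this, fderiv_const_smul_field]
    simp
  · have : (fun y => cwMetric e P y k l) = fun _ => cwMetric e P x k l := by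
      funext y
      simp [cwMetric, h]
    simp [this, h]

theorem inv_cwMetric_mulVec (S : Fin (e + 2) → ℝ) :
    ((cwMetric e P x)⁻¹ *ᵥ S) 0 = -S 1 ∧
    ((cwMetric e P x)⁻¹ *ᵥ S) 1 = 2 * cwProfile e P x * S 1 - S 0 ∧
    ∀ i : Fin e, ((cwMetric e P x)⁻¹ *ᵥ S) i.succ.succ = S i.succ.succ := by
  let G : Matrix (Fin (e + 2)) (Fin (e + 2)) ℝ := fun k l =>
    (if k = 1 ∧ l = 1 then 2 * cwProfile e P x else 0)
    + (if (k = 0 ∧ l = 1) ∨ (k = 1 ∧ l = 0) then -1 else 0)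
    + (if k = l ∧ 2 ≤ (k : ℕ) then 1 else 0)
  have hne₁ : ∀ i : Fin e, i.succ.succ ≠ (1 : Fin (e + 2)) := fun i => by simp [Fin.ext_iff]
  have hne₀ : ∀ i : Fin e, (0 : Fin (e + 2)) ≠ i.succ.succ := fun i => by simp [Fin.ext_iff]
  have hG : cwMetric e P x * G = 1 := by
    ext k l
    rw [Matrix.mul_apply]
    refine Fin.cases ?_ (fun k => Fin.cases ?_ (fun k => ?_) k) k <;>
    refine Fin.cases ?_ (fun l => Fin.cases ?_ (fun l => ?_) l) l <;>
    simp [Fin.sum_univ_succ, cwMetric, G, Matrix.one_apply, cwProfile,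
      hne₁, hne₀, (hne₁ _).symm]
  rw [Matrix.inv_eq_right_inv hG]
  refine ⟨?_, ?_, fun i => ?_⟩ <;>
  simp [Matrix.mulVec, dotProduct, Fin.sum_univ_succ, G, hne₁]
  ring

theorem sum_christoffel_cwMetric (w : Fin (e + 2) → ℝ) (k : Fin (e + 2)) :
    ∑ i, ∑ j, christoffel (cwMetric e P) x k i j * w i * w j
      = ((cwMetric e P x)⁻¹ *ᵥ fun l => w 0 ^ 2 * pd l (cwProfile e P) x
          - if l = 0 then 2 * w 0 * fderiv ℝ (cwProfile e P) x w else 0) k := by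
  have hsum : ∀ l, ∑ i, ∑ j, (pd i (fun y => cwMetric e P y l j) x
      + pd j (fun y => cwMetric e P y l i) x - pd l (fun y => cwMetric e P y i j) x) * w i * w j
      = 2 * (w 0 ^ 2 * pd l (cwProfile e P) x
          - if l = 0 then 2 * w 0 * fderiv ℝ (cwProfile e P) x w else 0) := fun l => by
    have hfd := sum_pd_mul (cwProfile e P) x w
    simp only [pd_cwMetric, add_mul, sub_mul, Finset.sum_add_distrib, Finset.sum_sub_distrib,
      ite_and, ite_mul, zero_mul]
    by_cases hl : l = 0
    · simp only [hl, if_true, Finset.sum_ite_eq', Finset.mem_univ, ← hfd, Finset.mul_sum,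
        Finset.sum_ite_irrel, Finset.sum_const_zero, ← Finset.sum_add_distrib]
      rw [mul_sub, Finset.mul_sum, sub_eq_add_neg, sub_eq_add_neg, add_comm,
        ← Finset.sum_neg_distrib]
      refine congrArg₂ _ (by ring) (Finset.sum_congr rfl fun i _ => by ring)
    · simp [hl, Finset.sum_ite_irrel]
      ring
  calc ∑ i, ∑ j, christoffel (cwMetric e P) x k i j * w i * w j
      = ∑ i, ∑ j, ∑ l, (cwMetric e P x)⁻¹ k l * ((1 / 2) * ((pd i (fun y => cwMetric e P y l j) x
          + pd j (fun y => cwMetric e P y l i) x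
          - pd l (fun y => cwMetric e P y i j) x) * w i * w j)) := by
        refine Finset.sum_congr rfl fun i _ => Finset.sum_congr rfl fun j _ => ?_
        rw [christoffel, Finset.mul_sum, Finset.sum_mul, Finset.sum_mul]
        exact Finset.sum_congr rfl fun l _ => by ring
    _ = ∑ l, (cwMetric e P x)⁻¹ k l * ((1 / 2) * ∑ i, ∑ j, (pd i (fun y => cwMetric e P y l j) x
          + pd j (fun y => cwMetric e P y l i) x
          - pd l (fun y => cwMetric e P y i j) x) * w i * w j) := by
        simp only [Finset.mul_sum]
        rw [Finset.sum_comm_cycle]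
    _ = _ := by
        refine Finset.sum_congr rfl fun l _ => ?_
        rw [hsum]
        ring

theorem sum_christoffel_cwMetric_zero {P' : Matrix (Fin e) (Fin e) ℝ}
    (hP : ∀ i j, HasDerivAt (fun u => P u i j) (P' i j) (x 0)) (w : Fin (e + 2) → ℝ) :
    ∑ i, ∑ j, christoffel (cwMetric e P) x 0 i j * w i * w j = 0 := by
  have h1 : pd 1 (cwProfile e P) x = 0 := by
    rw [pd, fderiv_cwProfile hP]
    simp [Fin.ext_iff]
  rw [sum_christoffel_cwMetric, (inv_cwMetric_mulVec _).1]
  simp [h1]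

theorem sum_christoffel_cwMetric_one {P' : Matrix (Fin e) (Fin e) ℝ} (hsymm : (P (x 0)).IsSymm)
    (hP : ∀ i j, HasDerivAt (fun u => P u i j) (P' i j) (x 0)) (w : Fin (e + 2) → ℝ) :
    ∑ i, ∑ j, christoffel (cwMetric e P) x 1 i j * w i * w j
      = w 0 ^ 2 * ∑ i : Fin e, ∑ j : Fin e, P' i j * x i.succ.succ * x j.succ.succ
        + 4 * w 0 * ∑ i : Fin e, ∑ j : Fin e,
          P (x 0) i j * x i.succ.succ * w j.succ.succ := by
  have h1 : pd 1 (cwProfile e P) x = 0 := by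
    rw [pd, fderiv_cwProfile hP]
    simp [Fin.ext_iff]
  have h0 : pd 0 (cwProfile e P) x
      = ∑ i : Fin e, ∑ j : Fin e, P' i j * x i.succ.succ * x j.succ.succ := by
    rw [pd, fderiv_cwProfile hP]
    simp [Fin.ext_iff]
  have hswap : ∑ i : Fin e, ∑ j : Fin e, P (x 0) i j * w i.succ.succ * x j.succ.succ
      = ∑ i : Fin e, ∑ j : Fin e, P (x 0) i j * x i.succ.succ * w j.succ.succ := by
    rw [Finset.sum_comm]
    refine Finset.sum_congr rfl fun i _ => Finset.sum_congr rfl fun j _ => ?_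
    rw [hsymm.apply]
    ring
  have hw : fderiv ℝ (cwProfile e P) x w
      = w 0 * (∑ i : Fin e, ∑ j : Fin e, P' i j * x i.succ.succ * x j.succ.succ)
        + 2 * ∑ i : Fin e, ∑ j : Fin e, P (x 0) i j * x i.succ.succ * w j.succ.succ := by
    rw [fderiv_cwProfile hP]
    simp only [Finset.sum_add_distrib, hswap]
    rw [two_mul, add_assoc, Finset.mul_sum]
    congr 1
    refine Finset.sum_congr rfl fun i _ => ?_
    rw [Finset.mul_sum]
    exact Finset.sum_congr rfl fun j _ => by ring
  rw [sum_christoffel_cwMetric, (inv_cwMetric_mulVec _).2.1]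
  simp only [h1, h0, hw, if_true, one_ne_zero, if_false]
  ring

theorem sum_christoffel_cwMetric_succ_succ {P' : Matrix (Fin e) (Fin e) ℝ}
    (hsymm : (P (x 0)).IsSymm)
    (hP : ∀ i j, HasDerivAt (fun u => P u i j) (P' i j) (x 0)) (w : Fin (e + 2) → ℝ)
    (k : Fin e) :
    ∑ i, ∑ j, christoffel (cwMetric e P) x k.succ.succ i j * w i * w j
      = 2 * w 0 ^ 2 * ∑ j : Fin e, P (x 0) k j * x j.succ.succ := by
  have hk : pd k.succ.succ (cwProfile e P) x = 2 * ∑ j : Fin e, P (x 0) k j * x j.succ.succ := by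
    rw [pd, fderiv_cwProfile hP]
    simp only [Pi.single_apply, Fin.succ_inj, (Fin.succ_ne_zero _).symm, if_false, mul_zero,
      zero_mul, zero_add, mul_ite, ite_mul, mul_one, Finset.sum_add_distrib,
      Finset.sum_ite_eq', Finset.mem_univ, if_true, Finset.sum_ite_irrel,
      Finset.sum_const_zero, two_mul]
    congr 1
    exact Finset.sum_congr rfl fun j _ => by rw [hsymm.apply]
  rw [sum_christoffel_cwMetric, (inv_cwMetric_mulVec _).2.2]
  simp only [hk, Fin.succ_ne_zero, if_false]
  ring

theorem isGeodesicCurve_cwMetric_iff {P' : ℝ → Matrix (Fin e) (Fin e) ℝ}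
    (hsymm : ∀ u, (P u).IsSymm)
    (hP : ∀ u i j, HasDerivAt (fun u => P u i j) (P' u i j) u)
    {I : Set ℝ} {c : ℝ → Fin (e + 2) → ℝ} :
    IsGeodesicCurve (cwMetric e P) I c ↔ ∀ t ∈ I,
      (∀ k, DifferentiableAt ℝ (fun s => c s k) t ∧ DifferentiableAt ℝ (deriv fun s => c s k) t) ∧
      deriv (deriv fun s => c s 0) t = 0 ∧
      deriv (deriv fun s => c s 1) t = -(deriv (fun s => c s 0) t ^ 2 * ∑ i : Fin e, ∑ j : Fin e,
          P' (c t 0) i j * c t i.succ.succ * c t j.succ.succ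
        + 4 * deriv (fun s => c s 0) t * ∑ i : Fin e, ∑ j : Fin e,
          P (c t 0) i j * c t i.succ.succ * deriv (fun s => c s j.succ.succ) t) ∧
      ∀ i : Fin e, deriv (deriv fun s => c s i.succ.succ) t
        = ∑ j, ((-2 * deriv (fun s => c s 0) t ^ 2) • P (c t 0)) i j * c t j.succ.succ := by
  refine forall₂_congr fun t _ => ?_
  have h0 := sum_christoffel_cwMetric_zero (hP (c t 0)) (fun k => deriv (fun s => c s k) t)
  have h1 := sum_christoffel_cwMetric_one (hsymm (c t 0)) (hP (c t 0))
    (fun k => deriv (fun s => c s k) t)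
  have h2 := sum_christoffel_cwMetric_succ_succ (hsymm (c t 0)) (hP (c t 0))
    (fun k => deriv (fun s => c s k) t)
  have h3 : ∀ i : Fin e, ∑ j, ((-2 * deriv (fun s => c s 0) t ^ 2) • P (c t 0)) i j
      * c t j.succ.succ
      = -(2 * deriv (fun s => c s 0) t ^ 2 * ∑ j, P (c t 0) i j * c t j.succ.succ) := fun i => by
    rw [Finset.mul_sum, ← Finset.sum_neg_distrib]
    refine Finset.sum_congr rfl fun j _ => ?_
    rw [Matrix.smul_apply, smul_eq_mul]
    ring
  simp only [h3, ← h1, ← h2, ← and_assoc, forall_and]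
  simp only [and_assoc]
  refine and_congr_right fun _ => and_congr_right fun _ => ?_
  rw [Fin.forall_fin_succ, Fin.forall_fin_succ]
  refine and_congr ?_ (and_congr ?_ (forall_congr' fun i => ?_))
  · rw [h0, add_zero]
  · exact add_eq_zero_iff_eq_neg
  · exact add_eq_zero_iff_eq_neg

/-- Along a geodesic `u` is an affine function of the parameter. -/
theorem IsGeodesicCurve.cwMetric_affine {P' : ℝ → Matrix (Fin e) (Fin e) ℝ}
    (hsymm : ∀ u, (P u).IsSymm)
    (hP : ∀ u i j, HasDerivAt (fun u => P u i j) (P' u i j) u)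
    {a b t₀ : ℝ} (ht₀ : t₀ ∈ Set.Ioo a b) {c : ℝ → Fin (e + 2) → ℝ}
    (hc : IsGeodesicCurve (cwMetric e P) (Set.Ioo a b) c) :
    ∀ t ∈ Set.Ioo a b, c t 0 = c t₀ 0 + deriv (fun s => c s 0) t₀ * (t - t₀) ∧
      deriv (fun s => c s 0) t = deriv (fun s => c s 0) t₀ := by
  have hc' := (isGeodesicCurve_cwMetric_iff hsymm hP).1 hc
  have h := eqOn_of_hasDerivAt_linear_second_order (L := fun _ => (0 : ℝ →L[ℝ] ℝ))
    (F := fun _ => 0) continuous_const ht₀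
    (x := fun s => c s 0) (w := deriv fun s => c s 0)
    (x' := fun t => c t₀ 0 + deriv (fun s => c s 0) t₀ * (t - t₀))
    (w' := fun _ => deriv (fun s => c s 0) t₀)
    (fun t ht => ((hc' t ht).1 0).1.hasDerivAt)
    (fun t ht => by simpa [(hc' t ht).2.1] using ((hc' t ht).1 0).2.hasDerivAt)
    (fun t _ => by
      simpa using (((hasDerivAt_id t).sub_const t₀).const_mul
        (deriv (fun s => c s 0) t₀)).const_add (c t₀ 0))
    (fun t _ => by simpa using hasDerivAt_const t _) (by simp) rfl
  exact fun t ht => ⟨h.1 ht, h.2 ht⟩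

/-- Plane waves with a continuously differentiable profile are geodesically complete. -/
theorem IsGeodesicCurve.exists_extension_cwMetric {P' : ℝ → Matrix (Fin e) (Fin e) ℝ}
    (hsymm : ∀ u, (P u).IsSymm)
    (hP : ∀ u i j, HasDerivAt (fun u => P u i j) (P' u i j) u)
    (hP' : ∀ i j, Continuous fun u => P' u i j)
    {a b t₀ : ℝ} (ht₀ : t₀ ∈ Set.Ioo a b) {c : ℝ → Fin (e + 2) → ℝ}
    (hc : IsGeodesicCurve (cwMetric e P) (Set.Ioo a b) c) :
    ∃ c' : ℝ → Fin (e + 2) → ℝ, IsGeodesicCurve (cwMetric e P) Set.univ c' ∧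
      ∀ t ∈ Set.Ioo a b, c' t = c t := by
  have hc' := (isGeodesicCurve_cwMetric_iff hsymm hP).1 hc
  have haff := hc.cwMetric_affine hsymm hP ht₀
  have hPc : ∀ i j, Continuous fun u => P u i j := fun i j =>
    continuous_iff_continuousAt.2 fun u => (hP u i j).continuousAt
  set q : ℝ := deriv (fun s => c s 0) t₀
  let u : ℝ → ℝ := fun t => c t₀ 0 + q * (t - t₀)
  have hu : ∀ t, HasDerivAt u q t := fun t => by
    simpa [u] using (((hasDerivAt_id t).sub_const t₀).const_mul q).const_add (c t₀ 0)
  have huc : Continuous u := by fun_prop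
  let M : ℝ → Matrix (Fin e) (Fin e) ℝ := fun t => (-2 * q ^ 2) • P (u t)
  let L : ℝ → (Fin e → ℝ) →L[ℝ] (Fin e → ℝ) := fun t =>
    (Matrix.toLin' (M t)).toContinuousLinearMap
  have hL : Continuous L := by
    have hM : Continuous M := continuous_matrix fun i j =>
      ((hPc i j).comp huc).const_smul (-2 * q ^ 2)
    exact ((Matrix.toLin'.trans LinearMap.toContinuousLinearMap).toLinearMap
      |>.continuous_of_finiteDimensional).comp hM
  obtain ⟨x, w, hx₀, hw₀, hx, hw⟩ := exists_forall_hasDerivAt_linear_second_order hL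
    (F := fun _ => 0) continuous_const t₀ (fun i => c t₀ i.succ.succ)
    (fun i => deriv (fun s => c s i.succ.succ) t₀)
  have hxc : Continuous x := continuous_iff_continuousAt.2 fun t => (hx t).continuousAt
  have hwc : Continuous w := continuous_iff_continuousAt.2 fun t => (hw t).continuousAt
  let F : ℝ → ℝ := fun t => -(q ^ 2 * ∑ i, ∑ j, P' (u t) i j * x t i * x t j
    + 4 * q * ∑ i, ∑ j, P (u t) i j * x t i * w t j)
  have hF : Continuous F := by
    have h1 : ∀ i j, Continuous fun t => P (u t) i j := fun i j => (hPc i j).comp huc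
    have h2 : ∀ i j, Continuous fun t => P' (u t) i j := fun i j => (hP' i j).comp huc
    fun_prop
  obtain ⟨v, z, hv₀, hz₀, hv, hz⟩ := exists_forall_hasDerivAt_linear_second_order
    (L := fun _ => (0 : ℝ →L[ℝ] ℝ)) continuous_const hF t₀ (c t₀ 1)
    (deriv (fun s => c s 1) t₀)
  have hspatial := eqOn_of_hasDerivAt_linear_second_order hL (F := fun _ => 0) ht₀
    (x := x) (w := w) (x' := fun t i => c t i.succ.succ)
    (w' := fun t i => deriv (fun s => c s i.succ.succ) t)
    (fun t _ => hx t) (fun t _ => hw t)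
    (fun t ht => hasDerivAt_pi.2 fun i => ((hc' t ht).1 i.succ.succ).1.hasDerivAt)
    (fun t ht => hasDerivAt_pi.2 fun i => by
      convert ((hc' t ht).1 i.succ.succ).2.hasDerivAt using 1
      rw [(hc' t ht).2.2.2 i, (haff t ht).1, (haff t ht).2]
      simp [L, M, u, Matrix.mulVec, dotProduct, Finset.mul_sum, mul_assoc])
    hx₀ hw₀
  have hvert := eqOn_of_hasDerivAt_linear_second_order
    (L := fun _ => (0 : ℝ →L[ℝ] ℝ)) continuous_const (F := F) ht₀
    (x := v) (w := z) (x' := fun t => c t 1) (w' := deriv fun s => c s 1)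
    (fun t _ => hv t) (fun t _ => hz t)
    (fun t ht => ((hc' t ht).1 1).1.hasDerivAt)
    (fun t ht => by
      convert ((hc' t ht).1 1).2.hasDerivAt using 1
      rw [(hc' t ht).2.2.1, (haff t ht).1, (haff t ht).2]
      simp [F, u, hspatial.1 ht, hspatial.2 ht])
    hv₀ hz₀
  have hx' : ∀ t i, HasDerivAt (fun s => x s i) (w t i) t := fun t => hasDerivAt_pi.1 (hx t)
  have hw' : ∀ t i, HasDerivAt (fun s => w s i) (∑ j, M t i j * x t j) t := fun t i => by
    simpa [L, Matrix.mulVec, dotProduct] using hasDerivAt_pi.1 (hw t) i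
  have hz' : ∀ t, HasDerivAt z (F t) t := fun t => by simpa using hz t
  have hdu : deriv u = fun _ => q := funext fun t => (hu t).deriv
  have hdv : deriv v = z := funext fun t => (hv t).deriv
  have hdx : ∀ i, (deriv fun s => x s i) = fun t => w t i := fun i =>
    funext fun t => (hx' t i).deriv
  refine ⟨fun t => emb e (u t) (v t) (x t),
    (isGeodesicCurve_cwMetric_iff hsymm hP).2 fun t _ => ⟨?_, ?_, ?_, fun i => ?_⟩,
    fun t ht => ?_⟩
  · rw [Fin.forall_fin_succ, Fin.forall_fin_succ]
    refine ⟨⟨(hu t).differentiableAt, ?_⟩, ⟨(hv t).differentiableAt, ?_⟩,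
      fun i => ⟨(hx' t i).differentiableAt, ?_⟩⟩
    · exact hdu ▸ differentiableAt_const q
    · exact hdv ▸ (hz' t).differentiableAt
    · exact hdx i ▸ (hw' t i).differentiableAt
  · change deriv (deriv u) t = 0
    simp [hdu]
  · change deriv (deriv v) t = -(deriv u t ^ 2 * ∑ i, ∑ j, P' (u t) i j * x t i * x t j
      + 4 * deriv u t * ∑ i, ∑ j, P (u t) i j * x t i * deriv (fun s => x s j) t)
    simp only [hdv, hdu, hdx, (hz' t).deriv, F]
  · change deriv (deriv fun s => x s i) t
      = ∑ j, ((-2 * deriv u t ^ 2) • P (u t)) i j * x t j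
    rw [hdx, hdu, (hw' t i).deriv]
  · funext k
    refine Fin.cases ?_ (fun k => Fin.cases ?_ (fun i => ?_) k) k
    · exact (haff t ht).1.symm
    · exact hvert.1 ht
    · exact congrFun (hspatial.1 ht) i

theorem analyticOnNhd_cwMetric (hP : ∀ i j, AnalyticOnNhd ℝ (fun u => P u i j) Set.univ)
    (k l : Fin (e + 2)) : AnalyticOnNhd ℝ (fun x => cwMetric e P x k l) Set.univ := by
  intro x _
  have hcoord : ∀ m : Fin (e + 2), AnalyticAt ℝ (fun y : Fin (e + 2) → ℝ => y m) x := fun m =>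
    (ContinuousLinearMap.proj (R := ℝ) (φ := fun _ : Fin (e + 2) => ℝ) m).analyticAt x
  refine (AnalyticAt.add ?_ analyticAt_const).add analyticAt_const
  split_ifs
  · refine analyticAt_const.mul (Finset.univ.analyticAt_fun_sum fun i _ =>
      Finset.univ.analyticAt_fun_sum fun j _ => ?_)
    have hPij : AnalyticAt ℝ (fun y : Fin (e + 2) → ℝ => P (y 0) i j) x :=
      AnalyticAt.comp (g := fun u => P u i j) (f := fun y : Fin (e + 2) → ℝ => y 0)
        (hP i j (x 0) (Set.mem_univ _)) (hcoord 0)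
    exact (hPij.mul (hcoord _)).mul (hcoord _)
  · exact analyticAt_const

end CahenWallach

/-!
## STATEMENT 9
Every generalized Cahen–Wallach spacetime `CW^d_r(A)` (here `d = e + 2`, `e ≥ 1`,
profile `A(u) = ∑_{l<r} uˡ • A^{(l)}`, `A^{(r-1)} ≠ 0`) has a real-analytic metric and
is geodesically complete; in particular its geodesic equations reduce, in the
coordinates `{u, v, xⁱ}`, to linear second-order ODEs with polynomial coefficients in
the affine parameter (`u'' = 0`, and the spatial components satisfy a linear system
with polynomial coefficient matrix), so every inextendible geodesic is defined on all
of `ℝ`.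
-/
theorem cw_analytic_and_geodesically_complete
    (e r : ℕ) (he : 1 ≤ e) (hr : 0 < r)
    (C : Fin r → Matrix (Fin e) (Fin e) ℝ)
    (hCsym : ∀ l, (C l).IsSymm)
    (hCtop : C ⟨r - 1, by omega⟩ ≠ 0) :
    -- the metric is real-analytic
    (∀ a b : Fin (e + 2), AnalyticOnNhd ℝ
      (fun x => cwMetric e (fun u => ∑ l : Fin r, u ^ (l : ℕ) • C l) x a b)
      Set.univ) ∧
    -- the geodesic equations reduce to linear second-order ODEs with polynomial
    -- coefficients in the affine parameter
    (∀ (t₀ t₁ : ℝ) (c : ℝ → Fin (e + 2) → ℝ),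
      IsGeodesicCurve (cwMetric e fun u => ∑ l : Fin r, u ^ (l : ℕ) • C l)
          (Set.Ioo t₀ t₁) c →
        (∀ t ∈ Set.Ioo t₀ t₁, deriv (deriv fun s => c s 0) t = 0) ∧
        ∃ Mc : ℝ → Matrix (Fin e) (Fin e) ℝ,
          (∀ i j, IsPolynomial1 fun t => Mc t i j) ∧
          ∀ t ∈ Set.Ioo t₀ t₁, ∀ i : Fin e,
            deriv (deriv fun s => c s i.succ.succ) t
              = ∑ j, Mc t i j * c t j.succ.succ) ∧
    -- geodesic completeness: every geodesic extends to all of ℝ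
    (∀ (t₀ t₁ : ℝ) (c : ℝ → Fin (e + 2) → ℝ), (Set.Ioo t₀ t₁).Nonempty →
      IsGeodesicCurve (cwMetric e fun u => ∑ l : Fin r, u ^ (l : ℕ) • C l)
          (Set.Ioo t₀ t₁) c →
        ∃ c' : ℝ → Fin (e + 2) → ℝ,
          IsGeodesicCurve (cwMetric e fun u => ∑ l : Fin r, u ^ (l : ℕ) • C l)
            Set.univ c' ∧
          ∀ t ∈ Set.Ioo t₀ t₁, c' t = c t) := by
  set P : ℝ → Matrix (Fin e) (Fin e) ℝ := fun u => ∑ l : Fin r, u ^ (l : ℕ) • C l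
  let p : Fin e → Fin e → Polynomial ℝ := fun i j =>
    ∑ l : Fin r, Polynomial.C (C l i j) * Polynomial.X ^ (l : ℕ)
  have hp : ∀ u i j, P u i j = (p i j).eval u := fun u i j => by
    simp only [P, p, Matrix.sum_apply, Matrix.smul_apply, smul_eq_mul, Polynomial.eval_finsetSum,
      Polynomial.eval_mul, Polynomial.eval_C, Polynomial.eval_pow, Polynomial.eval_X]
    exact Finset.sum_congr rfl fun l _ => mul_comm _ _
  have hsymm : ∀ u, (P u).IsSymm := fun u => by
    simp only [P, Matrix.IsSymm, Matrix.transpose_sum, Matrix.transpose_smul, (hCsym _).eq]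
  have hP : ∀ u i j, HasDerivAt (fun u => P u i j)
      (Matrix.of (fun i j => (p i j).derivative.eval u) i j) u := fun u i j => by
    simpa only [hp, Matrix.of_apply] using (p i j).hasDerivAt u
  refine ⟨analyticOnNhd_cwMetric fun i j => ?_, fun t₀ t₁ c hc => ?_, fun t₀ t₁ c ⟨s, hs⟩ hc =>
    hc.exists_extension_cwMetric hsymm hP (fun i j => (p i j).derivative.continuous) hs⟩
  · simpa only [hp] using AnalyticOnNhd.eval_polynomial (p i j)
  have hc' := (isGeodesicCurve_cwMetric_iff hsymm hP).1 hc
  refine ⟨fun t ht => (hc' t ht).2.1, ?_⟩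
  obtain hempty | ⟨s, hs⟩ := (Set.Ioo t₀ t₁).eq_empty_or_nonempty
  · exact ⟨0, fun i j => ⟨0, by simp⟩, by simp [hempty]⟩
  have haff := hc.cwMetric_affine hsymm hP hs
  set q : ℝ := deriv (fun s => c s 0) s
  refine ⟨fun t => (-2 * q ^ 2) • P (c s 0 + q * (t - s)), fun i j => ⟨Polynomial.C (-2 * q ^ 2) *
    (p i j).comp (Polynomial.C (c s 0) + Polynomial.C q * (Polynomial.X - Polynomial.C s)),
    fun t => ?_⟩, fun t ht i => ?_⟩
  · simp [hp]
  · rw [(hc' t ht).2.2.2 i, (haff t ht).1, (haff t ht).2]
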